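/- a_HHT(1) = a_HHT(2) = 0, a_HHT(3) = 1, and for all n ≥ 1, a_HHT(n+3) = 2·a_HHT(n+2) − a_HHT(n). -/

import Mathlib

/-- The number of binary sequences (lists of Booleans, `true` = H, `false` = T) of
length `n` in which the word `W` appears for the first time exactly at the end:
`W` is a suffix of `l` and `W` does not occur as a contiguous sublist of `l` with
its last entry removed. -/
noncomputable def firstCount (W : List Bool) (n : ℕ) : ℕ :=
  Nat.card {l : List Bool // l.length = n ∧ W <:+ l ∧ ¬ (W <:+: l.dropLast)}

/-- The set of first-occurrence lists of length `n`. -/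
def fset (n : ℕ) : Set (List Bool) :=
  {l | l.length = n ∧ [true, true, false] <:+ l ∧ ¬ ([true, true, false] <:+: l.dropLast)}

lemma firstCount_eq (n : ℕ) : firstCount [true, true, false] n = (fset n).ncard := rfl

lemma fset_finite (n : ℕ) : (fset n).Finite :=
  (List.finite_length_eq Bool n).subset fun _ h => h.1

lemma mem_cons (n : ℕ) (x : Bool) (l : List Bool) :
    x :: l ∈ fset (n + 4) ↔ l ∈ fset (n + 3) ∧ ¬ [true, true, false] <+: x :: l.dropLast := by
  by_cases hl : l.length = n + 3
  · have hne : l ≠ [] := by rintro rfl; simp at hl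
    have h1 : [true, true, false] ≠ x :: l := by
      intro h
      have := congrArg List.length h
      simp [hl] at this
    simp only [fset, Set.mem_setOf_eq, List.length_cons, hl, List.suffix_cons_iff, h1, false_or,
      List.dropLast_cons_of_ne_nil hne, List.infix_cons_iff]
    tauto
  · simp [fset, hl]

lemma mem_HT (n : ℕ) (hn : 1 ≤ n) (m : List Bool) :
    true :: false :: m ∈ fset (n + 2) ↔ m ∈ fset n := by
  by_cases hm : m.length = n
  · have hne : m ≠ [] := by rintro rfl; simp at hm; omega
    simp [fset, hm, List.suffix_cons_iff, List.dropLast_cons_of_ne_nil, hne, List.infix_cons_iff]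
  · simp [fset, hm]

lemma key (n : ℕ) (hn : 1 ≤ n) :
    fset (n + 3) ∪ (fun m => true :: true :: false :: m) '' fset n
      = List.cons true '' fset (n + 2) ∪ List.cons false '' fset (n + 2) := by
  obtain ⟨k, rfl⟩ : ∃ k, n = k + 1 := ⟨n - 1, by omega⟩
  ext l
  rcases l with _ | ⟨x, l⟩
  · simp [fset]
  · have h := mem_cons k x l
    have h2 := mem_HT (k + 1) hn
    rw [show k + 1 + 3 = k + 4 from rfl, show k + 1 + 2 = k + 3 from rfl] at *
    simp only [Set.mem_union, h, Set.mem_image, List.cons.injEq]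
    constructor
    · rintro (h | ⟨m, hm, rfl, rfl⟩)
      · cases x
        · exact Or.inr ⟨l, h.1, rfl, rfl⟩
        · exact Or.inl ⟨l, h.1, rfl, rfl⟩
      · exact Or.inl ⟨_, (h2 m).2 hm, rfl, rfl⟩
    · intro h'
      have hl : l ∈ fset (k + 3) := by
        rcases h' with ⟨_, a, _, rfl⟩ | ⟨_, a, _, rfl⟩ <;> exact a
      by_cases hp : [true, true, false] <+: x :: l.dropLast
      · right
        rw [List.cons_prefix_cons] at hp
        obtain ⟨rfl, hp⟩ := hp
        obtain ⟨t, rfl⟩ := hp.trans (List.dropLast_prefix l)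
        exact ⟨t, (h2 t).1 hl, rfl, rfl⟩
      · exact Or.inl ⟨hl, hp⟩

lemma fset_small (n : ℕ) (hn : n < 3) : fset n = ∅ := by
  ext l
  simp only [fset, Set.mem_setOf_eq, Set.mem_empty_iff_false, iff_false]
  rintro ⟨h, h1, -⟩
  have := h1.length_le
  simp at this
  omega

lemma fset_three : fset 3 = {[true, true, false]} := by
  ext l
  simp only [fset, Set.mem_setOf_eq, Set.mem_singleton_iff]
  constructor
  · rintro ⟨h, h1, -⟩
    exact (h1.eq_of_length (by simp [h])).symm
  · rintro rfl
    decide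

lemma rec_nat (n : ℕ) (hn : 1 ≤ n) :
    (fset (n + 3)).ncard + (fset n).ncard = 2 * (fset (n + 2)).ncard := by
  have h := congrArg Set.ncard (key n hn)
  rw [Set.ncard_union_eq ?_ (fset_finite _) ((fset_finite _).image _),
    Set.ncard_union_eq ?_ ((fset_finite _).image _) ((fset_finite _).image _),
    Set.ncard_image_of_injective, Set.ncard_image_of_injective,
    Set.ncard_image_of_injective] at h
  · omega
  · exact List.cons_injective
  · exact List.cons_injective
  · intro a b hab
    simpa using hab
  · rw [Set.disjoint_left]
    rintro _ ⟨a, _, rfl⟩ ⟨b, _, hb⟩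
    simp at hb
  · rw [Set.disjoint_left]
    rintro _ h1 ⟨m, hm, rfl⟩
    obtain ⟨k, rfl⟩ : ∃ k, n = k + 1 := ⟨n - 1, by omega⟩
    have hne : m ≠ [] := by rintro rfl; simp [fset] at hm
    refine ((mem_cons k _ _).1 h1).2 ?_
    simp [List.dropLast_cons_of_ne_nil, hne]

theorem stmt_10 :
    firstCount [true, true, false] 1 = 0 ∧ firstCount [true, true, false] 2 = 0 ∧
    firstCount [true, true, false] 3 = 1 ∧
    ∀ n : ℕ, 1 ≤ n →
      (firstCount [true, true, false] (n + 3) : ℤ)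
        = 2 * (firstCount [true, true, false] (n + 2) : ℤ)
          - (firstCount [true, true, false] n : ℤ) := by
  simp only [firstCount_eq]
  refine ⟨by simp [fset_small], by simp [fset_small], by simp [fset_three], ?_⟩
  intro n hn
  have := rec_nat n hn
  omega
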